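/- Let K_n be the complete undirected graph on n ≥ 3 vertices. For every valuation f : V → {1,…,n}, the expected convergence time of the asynchronous maximum model satisfies T(K_n, f) ≤ 1 + n·H_{n−2}, where H_m is the m-th harmonic number. In particular 𝒯(K_n) = Θ(n log n). -/

import Mathlib

open MeasureTheory
open scoped ENNReal

attribute [local instance] Classical.propDecidable

/-- The neighbours of `v` in `G`, as a finset. -/
noncomputable def nbrs {V : Type*} [Fintype V] (G : SimpleGraph V) (v : V) : Finset V :=
  Finset.univ.filter (fun u => G.Adj v u)

/-- The asynchronous maximum update of a valuation `f` at the vertex `v`: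
the value at `v` is replaced by the maximum of `f` over the neighbours of `v`
(if `v` has at least one neighbour; otherwise nothing changes), and all other
values are unchanged. -/
noncomputable def amUpdate {V : Type*} [Fintype V] (G : SimpleGraph V)
    (f : V → ℕ) (v : V) : V → ℕ :=
  fun u => if u = v ∧ (nbrs G v).Nonempty then (nbrs G v).sup f else f u

/-- The asynchronous maximum model: starting from the valuation `f`, at round `t` the vertex
`ω t` is chosen and updated. `amRun G f ω t` is the valuation after `t` rounds. -/
noncomputable def amRun {V : Type*} [Fintype V] (G : SimpleGraph V)
    (f : V → ℕ) (ω : ℕ → V) : ℕ → V → ℕ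
  | 0 => f
  | (t + 1) => amUpdate G (amRun G f ω t) (ω t)

/-- The convergence time along the update sequence `ω`: the least `t` such that the valuation
after `t` rounds is constant, and `∞` if no such `t` exists (as a value in `ℝ≥0∞`). -/
noncomputable def convTime {V : Type*} [Fintype V] (G : SimpleGraph V)
    (f : V → ℕ) (ω : ℕ → V) : ℝ≥0∞ :=
  ⨅ (t : ℕ) (_ : ∃ c : ℕ, amRun G f ω t = fun _ => c), (t : ℝ≥0∞)

/-- `μ` is the infinite product of uniform measures on `V`: a probability measure on `ℕ → V`
under which the coordinates are independent and uniformly distributed on `V`, i.e. every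
cylinder fixing the first `m` coordinates has measure `(1/|V|)^m`. -/
def IsUniformProduct {V : Type*} [Fintype V] [MeasurableSpace V]
    (μ : Measure (ℕ → V)) : Prop :=
  IsProbabilityMeasure μ ∧
    ∀ (m : ℕ) (g : ℕ → V),
      μ {ω | ∀ i < m, ω i = g i} = (1 / (Fintype.card V : ℝ≥0∞)) ^ m

/-- The `m`-th harmonic number `H_m = ∑_{i=1}^m 1/i`. -/
noncomputable def harmonic' (m : ℕ) : ℝ := ∑ i ∈ Finset.Icc 1 m, (1 : ℝ) / i

/-- The number of vertices at which `f` attains its maximum. -/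
noncomputable def maxCount {V : Type*} [Fintype V] (f : V → ℕ) : ℕ :=
  (Finset.univ.filter fun v => ∀ u, f u ≤ f v).card

/-- An upper bound for the expected convergence time of the asynchronous maximum model on the
complete graph, started at `f`. -/
noncomputable def maxPotential {V : Type*} [Fintype V] (f : V → ℕ) : ℝ :=
  if 2 ≤ maxCount f then Fintype.card V * harmonic' (Fintype.card V - maxCount f)
  else 1 + Fintype.card V * harmonic' (Fintype.card V - 2)

lemma harmonic'_nonneg (m : ℕ) : 0 ≤ harmonic' m :=
  Finset.sum_nonneg fun _ _ => by positivity

lemma harmonic'_succ (m : ℕ) : harmonic' (m + 1) = harmonic' m + 1 / ((m : ℝ) + 1) := by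
  unfold harmonic'
  rw [Finset.sum_Icc_succ_top (by omega)]
  push_cast
  rfl

lemma harmonic'_mono : Monotone harmonic' :=
  monotone_nat_of_le_succ fun m => by
    rw [harmonic'_succ]
    have : (0 : ℝ) ≤ 1 / ((m : ℝ) + 1) := by positivity
    linarith

section Update

variable {V : Type*} [Fintype V]

lemma maxCount_le_card (f : V → ℕ) : maxCount f ≤ Fintype.card V := Finset.card_le_univ _

lemma maxPotential_nonneg (f : V → ℕ) : 0 ≤ maxPotential f := by
  unfold maxPotential
  have h1 := harmonic'_nonneg (Fintype.card V - maxCount f)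
  have h2 := harmonic'_nonneg (Fintype.card V - 2)
  split_ifs <;> positivity

lemma maxPotential_le_of_le_maxCount {f : V → ℕ} {k : ℕ} (hk : 2 ≤ k) (h : k ≤ maxCount f) :
    maxPotential f ≤ Fintype.card V * harmonic' (Fintype.card V - k) := by
  rw [maxPotential, if_pos (hk.trans h)]
  exact mul_le_mul_of_nonneg_left (harmonic'_mono (by omega)) (by positivity)

lemma maxPotential_le (f : V → ℕ) :
    maxPotential f ≤ 1 + Fintype.card V * harmonic' (Fintype.card V - 2) := by
  by_cases h : 2 ≤ maxCount f
  · linarith [maxPotential_le_of_le_maxCount le_rfl h]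
  · rw [maxPotential, if_neg h]

lemma amUpdate_of_ne (G : SimpleGraph V) (f : V → ℕ) {u v : V} (h : u ≠ v) :
    amUpdate G f v u = f u := by
  simp [amUpdate, h]

lemma exists_amUpdate_top_self_eq (hV : 2 ≤ Fintype.card V) (f : V → ℕ) (v : V) :
    ∃ u, u ≠ v ∧ amUpdate ⊤ f v v = f u ∧ ∀ w, w ≠ v → f w ≤ f u := by
  have hne : (nbrs (⊤ : SimpleGraph V) v).Nonempty := by
    have : Nontrivial V := Fintype.one_lt_card_iff_nontrivial.1 (by omega)
    obtain ⟨u, hu⟩ := exists_ne v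
    exact ⟨u, by simp [nbrs, hu.symm]⟩
  obtain ⟨u, hu, hsup⟩ := Finset.exists_mem_eq_sup _ hne f
  refine ⟨u, ?_, ?_, fun w hw => ?_⟩
  · simpa [nbrs, eq_comm] using hu
  · simp [amUpdate, hne, hsup]
  · rw [← hsup]
    exact Finset.le_sup (f := f) (by simp [nbrs, hw.symm])

lemma two_le_maxCount_amUpdate_top (hV : 2 ≤ Fintype.card V) (f : V → ℕ) (v : V) :
    2 ≤ maxCount (amUpdate ⊤ f v) := by
  obtain ⟨u, huv, hv, hmax⟩ := exists_amUpdate_top_self_eq hV f v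
  have hle : ∀ w, amUpdate ⊤ f v w ≤ f u := fun w => by
    by_cases hw : w = v
    · rw [hw, hv]
    · rw [amUpdate_of_ne _ _ hw]
      exact hmax w hw
  rw [← Finset.card_pair huv]
  refine Finset.card_le_card fun x hx => ?_
  rw [Finset.mem_insert, Finset.mem_singleton] at hx
  rw [Finset.mem_filter]
  refine ⟨Finset.mem_univ _, fun w => (hle w).trans ?_⟩
  rcases hx with rfl | rfl
  · rw [amUpdate_of_ne _ _ huv]
  · rw [hv]

/-- If the maximum is attained twice, the updated vertex receives the maximal value. -/
lemma amUpdate_top_self_of_two_le {f : V → ℕ} (h2 : 2 ≤ maxCount f) (v w : V) :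
    f w ≤ amUpdate ⊤ f v v ∧ ∃ u, amUpdate ⊤ f v v = f u := by
  have hV := h2.trans (maxCount_le_card f)
  obtain ⟨u, huv, hv, hmax⟩ := exists_amUpdate_top_self_eq hV f v
  obtain ⟨x, hx, hxv⟩ := Finset.exists_mem_ne (show 1 < (Finset.univ.filter fun v =>
    ∀ u, f u ≤ f v).card from h2) v
  exact ⟨hv ▸ ((Finset.mem_filter.1 hx).2 w).trans (hmax x hxv), u, hv⟩

lemma amUpdate_top_eq_self {f : V → ℕ} (h2 : 2 ≤ maxCount f) {v : V} (hv : ∀ u, f u ≤ f v) :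
    amUpdate ⊤ f v = f := by
  funext w
  by_cases hw : w = v
  · subst hw
    obtain ⟨h1, u, hu⟩ := amUpdate_top_self_of_two_le h2 w w
    exact le_antisymm (hu ▸ hv u) h1
  · exact amUpdate_of_ne _ _ hw

lemma maxCount_succ_le_amUpdate_top {f : V → ℕ} (h2 : 2 ≤ maxCount f) {v : V}
    (hv : ¬ ∀ u, f u ≤ f v) : maxCount f + 1 ≤ maxCount (amUpdate ⊤ f v) := by
  have hle : ∀ x, (∀ u, f u ≤ f x) → ∀ w, amUpdate ⊤ f v w ≤ f x := fun x hx w => by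
    by_cases hw : w = v
    · subst hw
      obtain ⟨-, u, hu⟩ := amUpdate_top_self_of_two_le h2 w w
      exact hu ▸ hx u
    · rw [amUpdate_of_ne _ _ hw]
      exact hx w
  have hnot : v ∉ Finset.univ.filter fun v => ∀ u, f u ≤ f v := by simpa using hv
  rw [maxCount, ← Finset.card_insert_of_notMem hnot]
  refine Finset.card_le_card fun x hx => ?_
  rw [Finset.mem_filter]
  refine ⟨Finset.mem_univ _, fun w => ?_⟩
  rcases Finset.mem_insert.1 hx with rfl | hx
  · by_cases hw : w = x
    · rw [hw]
    · rw [amUpdate_of_ne _ _ hw]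
      exact (amUpdate_top_self_of_two_le h2 x w).1
  · have hx' := (Finset.mem_filter.1 hx).2
    have hxv : x ≠ v := fun h => hv (h ▸ hx')
    rw [amUpdate_of_ne _ f hxv]
    exact hle x hx' w

lemma exists_eq_const_of_maxCount {f : V → ℕ} (h : maxCount f = Fintype.card V) :
    ∃ c : ℕ, f = fun _ => c := by
  have huniv := (Finset.card_eq_iff_eq_univ _).1 h
  have hmax : ∀ v u, f u ≤ f v := fun v =>
    (Finset.mem_filter.1 (huniv ▸ Finset.mem_univ v)).2
  rcases isEmpty_or_nonempty V with _ | ⟨⟨v⟩⟩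
  · exact ⟨0, Subsingleton.elim _ _⟩
  · exact ⟨f v, funext fun u => le_antisymm (hmax v u) (hmax u v)⟩

/-- The potential decreases in expectation by at least one in each step before convergence. -/
lemma sum_maxPotential_amUpdate_le (hV : 2 ≤ Fintype.card V) (f : V → ℕ) :
    (if ∃ c : ℕ, f = fun _ => c then 0 else (1 : ℝ)) +
      (Fintype.card V : ℝ)⁻¹ * ∑ v, maxPotential (amUpdate ⊤ f v) ≤ maxPotential f := by
  set n := Fintype.card V with hn
  have hn0 : (0 : ℝ) < n := by exact_mod_cast (by omega : 0 < n)
  have hone : (if ∃ c : ℕ, f = fun _ => c then 0 else (1 : ℝ)) ≤ 1 := by split_ifs <;> norm_num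
  by_cases h2 : 2 ≤ maxCount f
  · rcases (maxCount_le_card f).eq_or_lt with hk | hk
    · rw [if_pos (exists_eq_const_of_maxCount hk)]
      have huniv := (Finset.card_eq_iff_eq_univ _).1 hk
      have hup : ∀ v, amUpdate ⊤ f v = f := fun v =>
        amUpdate_top_eq_self h2 (Finset.mem_filter.1 (huniv ▸ Finset.mem_univ v)).2
      simp only [hup, Finset.sum_const, Finset.card_univ, nsmul_eq_mul, ← hn]
      rw [inv_mul_cancel_left₀ hn0.ne', zero_add]
    · obtain ⟨m, hm⟩ : ∃ m, n = maxCount f + (m + 1) := ⟨n - maxCount f - 1, by omega⟩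
      have hsum : ∑ v, maxPotential (amUpdate ⊤ f v) ≤
          maxCount f * (n * harmonic' (m + 1)) + (m + 1) * (n * harmonic' m) := by
        have hbound : ∀ v, maxPotential (amUpdate ⊤ f v) ≤
            if ∀ u, f u ≤ f v then n * harmonic' (m + 1) else n * harmonic' m := fun v => by
          split_ifs with hv
          · rw [amUpdate_top_eq_self h2 hv]
            have := maxPotential_le_of_le_maxCount h2 le_rfl
            rwa [← hn, show n - maxCount f = m + 1 by omega] at this
          · have := maxPotential_le_of_le_maxCount (by omega) (maxCount_succ_le_amUpdate_top h2 hv)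
            rwa [← hn, show n - (maxCount f + 1) = m by omega] at this
        refine (Finset.sum_le_sum fun v _ => hbound v).trans_eq ?_
        rw [Finset.sum_ite, Finset.sum_const, Finset.sum_const, nsmul_eq_mul, nsmul_eq_mul]
        have hc := Finset.card_filter_add_card_filter_not (s := (Finset.univ : Finset V))
          (fun v => ∀ u, f u ≤ f v)
        rw [Finset.card_univ, ← hn] at hc
        have hc' : (Finset.univ.filter fun v => ¬ ∀ u, f u ≤ f v).card = m + 1 := by
          unfold maxCount at hm
          omega
        rw [hc', maxCount]
        push_cast
        rfl
      have hW : maxPotential f = n * harmonic' (m + 1) := by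
        rw [maxPotential, if_pos h2, ← hn, show n - maxCount f = m + 1 by omega]
      have hsum' := mul_le_mul_of_nonneg_left hsum (inv_nonneg.2 hn0.le)
      have hkr : (n : ℝ) = maxCount f + (m + 1) := by exact_mod_cast hm
      have hcalc : (n : ℝ)⁻¹ * (maxCount f * (n * harmonic' (m + 1)) + (m + 1) * (n * harmonic' m))
          = n * harmonic' (m + 1) - 1 := by
        have hm0 : (m : ℝ) + 1 ≠ 0 := by positivity
        rw [show (maxCount f : ℝ) = n - (m + 1) by linarith, harmonic'_succ]
        field_simp
        ring
      linarith
  · have hbound : ∀ v, maxPotential (amUpdate ⊤ f v) ≤ n * harmonic' (n - 2) := fun v =>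
      maxPotential_le_of_le_maxCount le_rfl (two_le_maxCount_amUpdate_top hV f v)
    have hsum := Finset.sum_le_sum fun v (_ : v ∈ Finset.univ) => hbound v
    rw [Finset.sum_const, Finset.card_univ, nsmul_eq_mul, ← hn] at hsum
    have hsum' := mul_le_mul_of_nonneg_left hsum (inv_nonneg.2 hn0.le)
    rw [inv_mul_cancel_left₀ hn0.ne'] at hsum'
    rw [maxPotential, if_neg h2, ← hn]
    linarith

lemma amRun_congr (G : SimpleGraph V) (f : V → ℕ) {ω ω' : ℕ → V} {t : ℕ}
    (h : ∀ i < t, ω i = ω' i) : amRun G f ω t = amRun G f ω' t := by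
  induction t with
  | zero => rfl
  | succ t ih => rw [amRun, amRun, ih fun i hi => h i (by omega), h t (by omega)]

lemma convTime_le_tsum (G : SimpleGraph V) (f : V → ℕ) (ω : ℕ → V) :
    convTime G f ω ≤ ∑' t, if ∃ c : ℕ, amRun G f ω t = fun _ => c then 0 else (1 : ℝ≥0∞) := by
  by_cases h : ∃ t, ∃ c : ℕ, amRun G f ω t = fun _ => c
  · refine (iInf₂_le (Nat.find h) (Nat.find_spec h)).trans ?_
    refine le_trans (le_of_eq ?_) (ENNReal.sum_le_tsum (Finset.range (Nat.find h)))
    rw [Finset.sum_congr rfl fun t ht => if_neg (Nat.find_min h (Finset.mem_range.1 ht))]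
    simp
  · rw [not_exists] at h
    simp [h]

lemma exists_amRun_eq_prefix [Nonempty V] (G : SimpleGraph V) (f : V → ℕ) (t : ℕ) :
    ∃ R : (Fin t → V) → V → ℕ, ∀ ω, amRun G f ω t = R fun i => ω i := by
  refine ⟨fun g => amRun G f
    (fun i => if h : i < t then g ⟨i, h⟩ else Classical.arbitrary V) t, fun ω => ?_⟩
  exact amRun_congr G f fun i hi => by simp [hi]

lemma ofReal_maxPotential_step (hV : 2 ≤ Fintype.card V) (f : V → ℕ) :
    (if ∃ c : ℕ, f = fun _ => c then 0 else (1 : ℝ≥0∞)) + (Fintype.card V : ℝ≥0∞)⁻¹ *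
      ∑ v, ENNReal.ofReal (maxPotential (amUpdate ⊤ f v)) ≤ ENNReal.ofReal (maxPotential f) := by
  have hn0 : (0 : ℝ) < Fintype.card V := by exact_mod_cast (by omega : 0 < Fintype.card V)
  refine le_trans (le_of_eq ?_) (ENNReal.ofReal_le_ofReal (sum_maxPotential_amUpdate_le hV f))
  have hs : 0 ≤ ∑ v, maxPotential (amUpdate ⊤ f v) :=
    Finset.sum_nonneg fun _ _ => maxPotential_nonneg _
  rw [ENNReal.ofReal_add (by split_ifs <;> norm_num) (by positivity),
    ENNReal.ofReal_mul (by positivity), ENNReal.ofReal_inv_of_pos hn0, ENNReal.ofReal_natCast,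
    ENNReal.ofReal_sum_of_nonneg fun _ _ => maxPotential_nonneg _]
  congr 1
  split_ifs <;> simp

variable [MeasurableSpace V] [MeasurableSingletonClass V] {μ : Measure (ℕ → V)}

lemma measurable_comp_prefix (m : ℕ) (F : (Fin m → V) → ℝ≥0∞) :
    Measurable fun ω : ℕ → V => F fun i => ω i :=
  (measurable_of_finite F).comp (measurable_pi_lambda _ fun _ => measurable_pi_apply _)

lemma IsUniformProduct.lintegral_prefix (hμ : IsUniformProduct μ) (m : ℕ)
    (F : (Fin m → V) → ℝ≥0∞) :
    ∫⁻ ω, F (fun i => ω i) ∂μ = ∑ g, F g * (1 / (Fintype.card V : ℝ≥0∞)) ^ m := by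
  have hmeas : Measurable fun (ω : ℕ → V) (i : Fin m) => ω i :=
    measurable_pi_lambda _ fun i => measurable_pi_apply _
  rw [← lintegral_map (f := F) (measurable_of_finite F) hmeas, lintegral_fintype]
  refine Finset.sum_congr rfl fun g _ => ?_
  rw [Measure.map_apply hmeas (measurableSet_singleton g)]
  congr 1
  have := hμ.1
  obtain ⟨ω₀⟩ : Nonempty (ℕ → V) := Measure.nonempty_of_neZero μ
  rw [← hμ.2 m fun i => if h : i < m then g ⟨i, h⟩ else ω₀ 0]
  congr 1
  ext ω
  simp only [Set.mem_preimage, Set.mem_singleton_iff, Set.mem_ofPred_eq, funext_iff]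
  exact ⟨fun h i hi => by simpa [hi] using h ⟨i, hi⟩, fun h i => by simpa using h i i.2⟩

lemma IsUniformProduct.lintegral_prefix_last (hμ : IsUniformProduct μ) (t : ℕ)
    (H : (Fin t → V) → V → ℝ≥0∞) :
    ∫⁻ ω, H (fun i => ω i) (ω t) ∂μ =
      ∫⁻ ω, (Fintype.card V : ℝ≥0∞)⁻¹ * ∑ v, H (fun i => ω i) v ∂μ := by
  rw [hμ.lintegral_prefix t fun g => (Fintype.card V : ℝ≥0∞)⁻¹ * ∑ v, H g v]
  have := hμ.lintegral_prefix (t + 1) fun g => H (Fin.init g) (g (Fin.last t))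
  simp only [Fin.init_def, Fin.val_castSucc, Fin.val_last] at this
  rw [this, ← (Fin.snocEquiv fun _ => V).sum_comp, Fintype.sum_prod_type, Finset.sum_comm]
  refine Finset.sum_congr rfl fun g _ => ?_
  rw [Finset.mul_sum, Finset.sum_mul]
  refine Finset.sum_congr rfl fun v _ => ?_
  simp [Fin.snocEquiv, pow_succ]
  ring

lemma measurable_comp_amRun [Nonempty V] (G : SimpleGraph V) (f : V → ℕ) (t : ℕ)
    (Φ : (V → ℕ) → ℝ≥0∞) : Measurable fun ω => Φ (amRun G f ω t) := by
  obtain ⟨R, hR⟩ := exists_amRun_eq_prefix G f t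
  simp only [hR]
  exact measurable_comp_prefix t fun g => Φ (R g)

lemma IsUniformProduct.lintegral_amRun_succ [Nonempty V] (hμ : IsUniformProduct μ)
    (G : SimpleGraph V) (f : V → ℕ) (t : ℕ) (Φ : (V → ℕ) → ℝ≥0∞) :
    ∫⁻ ω, Φ (amRun G f ω (t + 1)) ∂μ =
      ∫⁻ ω, (Fintype.card V : ℝ≥0∞)⁻¹ * ∑ v, Φ (amUpdate G (amRun G f ω t) v) ∂μ := by
  obtain ⟨R, hR⟩ := exists_amRun_eq_prefix G f t
  simp only [amRun, hR]
  exact hμ.lintegral_prefix_last t fun g v => Φ (amUpdate G (R g) v)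

lemma IsUniformProduct.sum_lintegral_le (hμ : IsUniformProduct μ) (hV : 2 ≤ Fintype.card V)
    (f : V → ℕ) (m : ℕ) :
    ∑ t ∈ Finset.range m,
        ∫⁻ ω, (if ∃ c : ℕ, amRun ⊤ f ω t = fun _ => c then 0 else (1 : ℝ≥0∞)) ∂μ +
      ∫⁻ ω, ENNReal.ofReal (maxPotential (amRun ⊤ f ω m)) ∂μ ≤
        ENNReal.ofReal (maxPotential f) := by
  have : Nonempty V := Fintype.card_pos_iff.1 (by omega)
  have := hμ.1
  induction m with
  | zero => simp [amRun]
  | succ m ih =>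
    refine le_trans ?_ ih
    rw [Finset.sum_range_succ, add_assoc]
    gcongr
    rw [hμ.lintegral_amRun_succ ⊤ f m fun h => ENNReal.ofReal (maxPotential h),
      ← lintegral_add_left (measurable_comp_amRun ⊤ f m fun h =>
        if ∃ c : ℕ, h = fun _ => c then 0 else (1 : ℝ≥0∞))]
    exact lintegral_mono fun ω => ofReal_maxPotential_step hV _

end Update

/-- for the complete graph `K_n` on `n ≥ 3` vertices and every valuation
`f : V → {1,…,n}`, the expected convergence time of the asynchronous maximum model satisfies
`T(K_n, f) ≤ 1 + n·H_{n-2}`.  In particular `𝒯(K_n) = Θ(n log n)`. -/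
theorem expected_convTime_complete {V : Type*} [Fintype V]
    [MeasurableSpace V] [MeasurableSingletonClass V] (n : ℕ) (hn3 : 3 ≤ n)
    (hn : Fintype.card V = n)
    (f : V → ℕ) (hf : ∀ v, f v ∈ Finset.Icc 1 n)
    (μ : Measure (ℕ → V)) (hμ : IsUniformProduct μ) :
    ∫⁻ ω, convTime (⊤ : SimpleGraph V) f ω ∂μ ≤
      ENNReal.ofReal (1 + (n : ℝ) * harmonic' (n - 2)) := by
  have hV : 2 ≤ Fintype.card V := by omega
  have : Nonempty V := Fintype.card_pos_iff.1 (by omega)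
  refine (lintegral_mono fun ω => convTime_le_tsum ⊤ f ω).trans ?_
  rw [lintegral_tsum fun t => (measurable_comp_amRun ⊤ f t fun h =>
    if ∃ c : ℕ, h = fun _ => c then 0 else (1 : ℝ≥0∞)).aemeasurable]
  refine ENNReal.tsum_le_of_sum_range_le fun m => ?_
  refine (le_self_add.trans (hμ.sum_lintegral_le hV f m)).trans (ENNReal.ofReal_le_ofReal ?_)
  exact hn ▸ maxPotential_le f
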